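/- arXiv:2511.11008 — 5 statements merged into one kernel-verified Lean document; each statement's English description precedes it below -/
import Mathlib

section
/- Let s : ω → ω be any fixed-point-free map (s(x) ≠ x for all x ∈ ω), and let h_s be the classical strategy with deterministic post-processing kernel k(y|x) = [y = s(x)]. Then the expected score of h_s in the complement sampling game on Bernstein–Vazirani subsets equals V(F_BV, h_s) = 1/(2^n − 1). -/
/-- A nonzero linear form on `(ZMod 2)^n` is equidistributed. -/
theorem two_mul_sum_dot {n : ℕ} {u : Fin n → ZMod 2} (hu : u ≠ 0) (f : ZMod 2 → ℝ) :
    2 * ∑ x : Fin n → ZMod 2, f (∑ i, u i * x i) = 2 ^ n * (f 0 + f 1) := by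
  obtain ⟨j, hj⟩ := Function.ne_iff.mp hu
  have huj : u j = 1 := (by decide : ∀ a : ZMod 2, a ≠ 0 → a = 1) _ hj
  have hshift : ∑ x : Fin n → ZMod 2, f (∑ i, u i * x i)
      = ∑ x : Fin n → ZMod 2, f (∑ i, u i * x i + 1) := by
    rw [← Equiv.sum_comp (Equiv.addRight (Pi.single j (1 : ZMod 2) : Fin n → ZMod 2))]
    refine Finset.sum_congr rfl fun x _ => ?_
    simp [mul_add, Finset.sum_add_distrib, Pi.single_apply, huj]
  have hpair : ∀ a : ZMod 2, f a + f (a + 1) = f 0 + f 1 := by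
    intro a
    obtain rfl | rfl := (by decide : ∀ a : ZMod 2, a = 0 ∨ a = 1) a
    · simp
    · rw [show (1 + 1 : ZMod 2) = 0 by decide, add_comm]
  rw [two_mul]
  nth_rewrite 2 [hshift]
  rw [← Finset.sum_add_distrib]
  simp [hpair, mul_add]

/-- The level sets of a nonzero linear form on `(ZMod 2)^n` have `2^n / 2` elements. -/
theorem card_dot_eq {n : ℕ} {u : Fin n → ZMod 2} (hu : u ≠ 0) (b : ZMod 2) :
    ((Finset.univ.filter (fun x : Fin n → ZMod 2 => ∑ i, u i * x i = b)).card : ℝ)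
      = 2 ^ n / 2 := by
  have h := two_mul_sum_dot hu (fun a => if a = b then 1 else 0)
  have hb : ((if (0 : ZMod 2) = b then 1 else 0) + (if (1 : ZMod 2) = b then 1 else 0) : ℝ)
      = 1 := by
    obtain rfl | rfl := (by decide : ∀ a : ZMod 2, a = 0 ∨ a = 1) b <;> simp
  rw [hb, Finset.sum_boole] at h
  linarith

/-- For `x ≠ y`, the scores of `y` against the level sets containing `x`
add up to `1` over all nonzero linear forms. -/
theorem sum_score_of_ne {n : ℕ} {x y : Fin n → ZMod 2} (hxy : y ≠ x) :
    ∑ u ∈ Finset.univ.filter (fun u : Fin n → ZMod 2 => u ≠ 0),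
      (if ∑ i, u i * y i = ∑ i, u i * x i then (-1 : ℝ) else 1) = 1 := by
  have h := two_mul_sum_dot (sub_ne_zero.mpr hxy) (fun a => if a = 0 then (-1 : ℝ) else 1)
  have hdot : ∀ u : Fin n → ZMod 2,
      ∑ i, (y - x) i * u i = ∑ i, u i * y i - ∑ i, u i * x i := fun u => by
    rw [← Finset.sum_sub_distrib]
    exact Finset.sum_congr rfl fun i _ => by rw [Pi.sub_apply]; ring
  simp only [hdot, sub_eq_zero, if_true, one_ne_zero, if_false] at h
  rw [← Finset.add_sum_erase _ _ (Finset.mem_univ 0)] at h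
  rw [Finset.filter_ne']
  simp only [Pi.zero_apply, zero_mul, if_true] at h
  linarith

/-- The scores of the strategy post-processing by `s` on the two level sets of `u`. -/
theorem sum_score_eq {n : ℕ} (s : (Fin n → ZMod 2) → (Fin n → ZMod 2))
    {u : Fin n → ZMod 2} (hu : u ≠ 0) :
    ∑ b : ZMod 2, ∑ y : Fin n → ZMod 2,
      (∑ x ∈ Finset.univ.filter (fun x : Fin n → ZMod 2 => ∑ i, u i * x i = b),
          ((Finset.univ.filter
              (fun x : Fin n → ZMod 2 => ∑ i, u i * x i = b)).card : ℝ)⁻¹ *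
            (if y = s x then 1 else 0)) *
        (if ∑ i, u i * y i = b then (-1 : ℝ) else 1)
      = ((2 : ℝ) ^ n / 2)⁻¹ * ∑ x : Fin n → ZMod 2,
          (if ∑ i, u i * s x i = ∑ i, u i * x i then (-1 : ℝ) else 1) := by
  rw [Finset.mul_sum, ← Finset.sum_fiberwise Finset.univ
    (fun x : Fin n → ZMod 2 => ∑ i, u i * x i)]
  refine Finset.sum_congr rfl fun b _ => ?_
  simp_rw [card_dot_eq hu b, Finset.sum_mul]
  rw [Finset.sum_comm]
  refine Finset.sum_congr rfl fun x hx => ?_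
  rw [(Finset.mem_filter.mp hx).2]
  rw [Finset.sum_eq_single (s x) (fun y _ hy => by rw [if_neg hy, mul_zero, zero_mul])
    (fun h => absurd (Finset.mem_univ _) h), if_pos rfl, mul_one]


/-- Let `s : ω → ω` be fixed-point-free and let `h_s` be the classical
strategy with deterministic post-processing kernel `k(y|x) = [y = s(x)]`
(measure `|S⟩` in the computational basis, then apply `s`). Then the expected score of
`h_s` on Bernstein–Vazirani subsets equals `V(F_BV, h_s) = 1/(2^n − 1)`. -/
theorem stmt5 (n : ℕ) (hn : 1 ≤ n)
    (s : (Fin n → ZMod 2) → (Fin n → ZMod 2)) (hs : ∀ x, s x ≠ x) :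
    (1 / (2 * ((2 : ℝ) ^ n - 1))) *
      ∑ u ∈ Finset.univ.filter (fun u : Fin n → ZMod 2 => u ≠ 0), ∑ b : ZMod 2,
        ∑ y : Fin n → ZMod 2,
          (∑ x ∈ Finset.univ.filter (fun x : Fin n → ZMod 2 => ∑ i, u i * x i = b),
              ((Finset.univ.filter
                  (fun x : Fin n → ZMod 2 => ∑ i, u i * x i = b)).card : ℝ)⁻¹ *
                (if y = s x then 1 else 0)) *
            (if ∑ i, u i * y i = b then (-1 : ℝ) else 1)
      = 1 / ((2 : ℝ) ^ n - 1) := by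
  rw [Finset.sum_congr rfl fun u hu => sum_score_eq s (Finset.mem_filter.mp hu).2,
    ← Finset.mul_sum, Finset.sum_comm,
    Finset.sum_congr rfl fun x _ => sum_score_of_ne (hs x)]
  have hpos : (2 : ℝ) ^ n - 1 ≠ 0 :=
    (sub_pos.mpr (one_lt_pow₀ one_lt_two (by omega))).ne'
  simp only [Finset.sum_const, Finset.card_univ, Fintype.card_pi, ZMod.card,
    Finset.prod_const, Fintype.card_fin, nsmul_eq_mul, mul_one, Nat.cast_pow, Nat.cast_ofNat]
  field_simp
end

section
/- Every classical strategy h for the complement sampling game on Bernstein–Vazirani subsets has expected score V(F_BV, h) ≤ 1/(2^n − 1). -/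
open Finset in
/-- A nonzero linear form over `𝔽₂` takes each value equally often. -/
lemma sum_sign_linear_form_eq_zero {n : ℕ} {u : Fin n → ZMod 2} (hu : u ≠ 0) (b : ZMod 2) :
    ∑ x : Fin n → ZMod 2, (if ∑ i, u i * x i = b then (-1 : ℝ) else 1) = 0 := by
  obtain ⟨i, hi⟩ := Function.ne_iff.mp hu
  have hi1 : u i = 1 := (by decide : ∀ a : ZMod 2, a ≠ 0 → a = 1) _ hi
  have flip (x : Fin n → ZMod 2) :
      (if ∑ j, u j * (x + Pi.single i 1 : Fin n → ZMod 2) j = b then (-1 : ℝ) else 1) =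
        -(if ∑ j, u j * x j = b then (-1 : ℝ) else 1) := by
    have h : ∑ j, u j * (x + Pi.single i 1 : Fin n → ZMod 2) j = ∑ j, u j * x j + 1 := by
      simp [mul_add, sum_add_distrib, Pi.single_apply, hi1]
    have h2 : ∀ a c : ZMod 2, a + 1 = c ↔ ¬ a = c := by decide
    rw [h]
    by_cases hb : ∑ j, u j * x j = b <;> simp [h2, hb]
  have hS := Equiv.sum_comp (Equiv.addRight (Pi.single i 1 : Fin n → ZMod 2))
    (fun x => if ∑ j, u j * x j = b then (-1 : ℝ) else 1)
  have hneg := hS.symm.trans (sum_congr rfl fun x _ => flip x)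
  rw [sum_neg_distrib] at hneg
  linarith

open Finset in
lemma two_mul_card_linear_form_eq {n : ℕ} {u : Fin n → ZMod 2} (hu : u ≠ 0) (b : ZMod 2) :
    2 * (#{x : Fin n → ZMod 2 | ∑ i, u i * x i = b} : ℝ) = 2 ^ n := by
  have h (x : Fin n → ZMod 2) : (if ∑ i, u i * x i = b then (-1 : ℝ) else 1) =
      1 - 2 * (if ∑ i, u i * x i = b then 1 else 0) := by
    split_ifs <;> norm_num
  have hS := sum_sign_linear_form_eq_zero hu b
  simp only [h, sum_sub_distrib, ← mul_sum, sum_boole] at hS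
  simp only [sum_const, card_univ, Fintype.card_pi, ZMod.card, prod_const, Fintype.card_fin,
    nsmul_eq_mul, Nat.cast_pow, Nat.cast_ofNat, mul_one] at hS
  linarith

open Finset in
lemma sum_nonzero_sign_agree_le_one {n : ℕ} (x y : Fin n → ZMod 2) :
    ∑ u ∈ univ.filter (fun u : Fin n → ZMod 2 => u ≠ 0),
      (if ∑ i, u i * y i = ∑ i, u i * x i then (-1 : ℝ) else 1) ≤ 1 := by
  by_cases hxy : y = x
  · subst hxy
    simp only [if_true, sum_neg_distrib]
    exact (neg_nonpos.mpr (sum_nonneg fun _ _ => zero_le_one)).trans zero_le_one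
  · have h (u : Fin n → ZMod 2) :
        ∑ i, u i * y i = ∑ i, u i * x i ↔ ∑ i, (y - x) i * u i = 0 := by
      rw [← sub_eq_zero, ← sum_sub_distrib]
      simp only [Pi.sub_apply, sub_mul, mul_comm (u _)]
    have hS := sum_sign_linear_form_eq_zero (sub_ne_zero.mpr hxy) 0
    simp only [h]
    rw [filter_ne', sum_erase_eq_sub (mem_univ 0), hS]
    simp

open Finset in
lemma sum_score_linear_form {n : ℕ} (k : (Fin n → ZMod 2) → (Fin n → ZMod 2) → ℝ)
    {u : Fin n → ZMod 2} (hu : u ≠ 0) :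
    ∑ b : ZMod 2, ∑ y : Fin n → ZMod 2,
      (∑ x ∈ univ.filter (fun x : Fin n → ZMod 2 => ∑ i, u i * x i = b),
        ((univ.filter (fun x : Fin n → ZMod 2 => ∑ i, u i * x i = b)).card : ℝ)⁻¹ * k x y) *
        (if ∑ i, u i * y i = b then (-1 : ℝ) else 1) =
      2 / 2 ^ n * ∑ x, ∑ y, k x y *
        (if ∑ i, u i * y i = ∑ i, u i * x i then (-1 : ℝ) else 1) := by
  have hc (b : ZMod 2) : (#{x : Fin n → ZMod 2 | ∑ i, u i * x i = b} : ℝ)⁻¹ = 2 / 2 ^ n := by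
    rw [← two_mul_card_linear_form_eq hu b, div_mul_cancel_left₀ two_ne_zero]
  rw [← sum_fiberwise univ (fun x : Fin n → ZMod 2 => ∑ i, u i * x i), mul_sum]
  refine sum_congr rfl fun b _ => ?_
  simp only [hc, sum_mul]
  rw [sum_comm, mul_sum]
  refine sum_congr rfl fun x hx => ?_
  rw [(mem_filter.mp hx).2, mul_sum]
  exact sum_congr rfl fun y _ => mul_assoc _ _ _

/-- Every classical strategy (measure the subset state in the
computational basis, then post-process with a stochastic kernel `k`) for the complement
sampling game on Bernstein–Vazirani subsets has expected score
`V(F_BV, h) ≤ 1/(2^n − 1)`. -/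
theorem stmt6 (n : ℕ) (hn : 1 ≤ n)
    (k : (Fin n → ZMod 2) → (Fin n → ZMod 2) → ℝ)
    (hk0 : ∀ x y, 0 ≤ k x y) (hk1 : ∀ x, ∑ y, k x y = 1) :
    (1 / (2 * ((2 : ℝ) ^ n - 1))) *
      ∑ u ∈ Finset.univ.filter (fun u : Fin n → ZMod 2 => u ≠ 0), ∑ b : ZMod 2,
        ∑ y : Fin n → ZMod 2,
          (∑ x ∈ Finset.univ.filter (fun x : Fin n → ZMod 2 => ∑ i, u i * x i = b),
              ((Finset.univ.filter
                  (fun x : Fin n → ZMod 2 => ∑ i, u i * x i = b)).card : ℝ)⁻¹ * k x y) *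
            (if ∑ i, u i * y i = b then (-1 : ℝ) else 1)
      ≤ 1 / ((2 : ℝ) ^ n - 1) := by
  have hN : (2 : ℝ) ≤ 2 ^ n := by
    simpa using pow_le_pow_right₀ (one_le_two : (1 : ℝ) ≤ 2) hn
  rw [Finset.sum_congr rfl fun u hu => sum_score_linear_form k (Finset.mem_filter.mp hu).2,
    ← Finset.mul_sum, Finset.sum_comm]
  have hsum : ∑ x, ∑ u ∈ Finset.univ.filter (fun u : Fin n → ZMod 2 => u ≠ 0), ∑ y, k x y *
      (if ∑ i, u i * y i = ∑ i, u i * x i then (-1 : ℝ) else 1) ≤ 2 ^ n := by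
    calc _ ≤ ∑ _x : Fin n → ZMod 2, (1 : ℝ) := by
          refine Finset.sum_le_sum fun x _ => ?_
          rw [Finset.sum_comm]
          refine le_of_le_of_eq ?_ (hk1 x)
          refine Finset.sum_le_sum fun y _ => ?_
          rw [← Finset.mul_sum]
          exact mul_le_of_le_one_right (hk0 x y) (sum_nonzero_sign_agree_le_one x y)
      _ = 2 ^ n := by simp
  have hpos : (0 : ℝ) < 2 ^ n - 1 := by linarith
  calc _ ≤ 1 / (2 * ((2 : ℝ) ^ n - 1)) * (2 / 2 ^ n * 2 ^ n) := by gcongr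
    _ = 1 / ((2 : ℝ) ^ n - 1) := by field_simp
end

section
/- (Unconditional exponential violation of classicality.) The supremum of the expected score V(F_BV, h) over all classical strategies h equals 1/(2^n − 1) and is attained; the supremum over all strategies equals 1 and is attained; hence the ratio of the optimal value over all strategies to the optimal classical value equals 2^n − 1. -/
open Finset

/-- The sum of a nontrivial `±1` character of `𝔽₂ⁿ` vanishes. -/
lemma sum_sign_dotProduct_eq_zero {n : ℕ} {u : Fin n → ZMod 2} (hu : u ≠ 0) (b : ZMod 2) :
    ∑ x : Fin n → ZMod 2, (if u ⬝ᵥ x = b then (-1 : ℝ) else 1) = 0 := by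
  obtain ⟨i, hi⟩ := Function.ne_iff.mp hu
  have hi1 : u i = 1 := by
    have key : ∀ a : ZMod 2, a ≠ 0 → a = 1 := by decide
    exact key _ hi
  have hshift : ∑ x : Fin n → ZMod 2, (if u ⬝ᵥ x = b then (-1 : ℝ) else 1)
      = ∑ x : Fin n → ZMod 2, -(if u ⬝ᵥ x = b then (-1 : ℝ) else 1) := by
    rw [← Equiv.sum_comp (Equiv.addRight (Pi.single i (1 : ZMod 2)))
      (fun x => if u ⬝ᵥ x = b then (-1 : ℝ) else 1)]
    refine sum_congr rfl fun x _ => ?_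
    have key : ∀ a b : ZMod 2, a + 1 = b ↔ ¬ a = b := by decide
    simp only [Equiv.coe_addRight, dotProduct_add, dotProduct_single, hi1, mul_one, key]
    by_cases h : u ⬝ᵥ x = b <;> simp [h]
  rw [sum_neg_distrib] at hshift
  linarith

lemma two_mul_card_filter_dotProduct_eq {n : ℕ} {u : Fin n → ZMod 2} (hu : u ≠ 0) (b : ZMod 2) :
    2 * (#{x : Fin n → ZMod 2 | u ⬝ᵥ x = b} : ℝ) = 2 ^ n := by
  have h := sum_sign_dotProduct_eq_zero hu b
  have hsplit : ∀ x : Fin n → ZMod 2, (if u ⬝ᵥ x = b then (-1 : ℝ) else 1)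
      = 1 - 2 * (if u ⬝ᵥ x = b then 1 else 0) := by
    intro x
    split_ifs <;> norm_num
  simp only [hsplit, sum_sub_distrib, ← mul_sum, sum_boole] at h
  simp at h
  linarith

lemma sum_ne_zero_sign_dotProduct {n : ℕ} (x y : Fin n → ZMod 2) :
    ∑ u : Fin n → ZMod 2 with u ≠ 0, (if u ⬝ᵥ y = u ⬝ᵥ x then (-1 : ℝ) else 1)
      = 1 - (if x = y then (2 : ℝ) ^ n else 0) := by
  have hall : ∑ u : Fin n → ZMod 2, (if u ⬝ᵥ y = u ⬝ᵥ x then (-1 : ℝ) else 1)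
      = - (if x = y then (2 : ℝ) ^ n else 0) := by
    split_ifs with h
    · subst h
      simp
    · have hd : y - x ≠ 0 := sub_ne_zero.mpr (Ne.symm h)
      rw [neg_zero, ← sum_sign_dotProduct_eq_zero hd 0]
      refine sum_congr rfl fun u _ => ?_
      simp only [dotProduct_comm (y - x) u, dotProduct_sub, sub_eq_zero]
  rw [filter_ne', sum_erase_eq_sub (mem_univ _), hall]
  simp
  ring

lemma card_filter_ne_zero_bitString (n : ℕ) :
    (#{u : Fin n → ZMod 2 | u ≠ 0} : ℝ) = 2 ^ n - 1 := by
  rw [filter_ne', card_erase_of_mem (mem_univ _), Nat.cast_pred (card_pos.mpr ⟨0, mem_univ _⟩)]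
  simp

/-- The unnormalised score of a classical strategy depends only on the diagonal of its kernel. -/
lemma sum_score_classical {n : ℕ} (k : (Fin n → ZMod 2) → (Fin n → ZMod 2) → ℝ)
    (hk : ∀ x, ∑ y, k x y = 1) :
    ∑ u : Fin n → ZMod 2 with u ≠ 0, ∑ b : ZMod 2, ∑ y : Fin n → ZMod 2,
      (∑ x : Fin n → ZMod 2 with u ⬝ᵥ x = b,
        (#{x : Fin n → ZMod 2 | u ⬝ᵥ x = b} : ℝ)⁻¹ * k x y)
        * (if u ⬝ᵥ y = b then (-1 : ℝ) else 1)
      = 2 * (1 - ∑ x, k x x) := by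
  have hN : (2 : ℝ) ^ n ≠ 0 := by positivity
  have hcollapse : ∀ u ∈ ({u : Fin n → ZMod 2 | u ≠ 0} : Finset _),
      ∑ b : ZMod 2, ∑ y : Fin n → ZMod 2,
        (∑ x : Fin n → ZMod 2 with u ⬝ᵥ x = b,
          (#{x : Fin n → ZMod 2 | u ⬝ᵥ x = b} : ℝ)⁻¹ * k x y)
          * (if u ⬝ᵥ y = b then (-1 : ℝ) else 1)
      = ∑ x, ∑ y, 2 / 2 ^ n * k x y * (if u ⬝ᵥ y = u ⬝ᵥ x then (-1 : ℝ) else 1) := by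
    intro u hu
    have hcard : ∀ b, (#{x : Fin n → ZMod 2 | u ⬝ᵥ x = b} : ℝ)⁻¹ = 2 / 2 ^ n := by
      intro b
      have h := two_mul_card_filter_dotProduct_eq (mem_filter.mp hu).2 b
      rw [← h, div_mul_cancel_left₀ two_ne_zero]
    simp only [hcard, sum_filter, sum_mul]
    calc _ = ∑ b : ZMod 2, ∑ x, ∑ y, (if u ⬝ᵥ x = b then 2 / 2 ^ n * k x y else 0)
            * (if u ⬝ᵥ y = b then (-1 : ℝ) else 1) := sum_congr rfl fun b _ => sum_comm
      _ = ∑ x, ∑ y, ∑ b : ZMod 2, (if u ⬝ᵥ x = b then 2 / 2 ^ n * k x y else 0)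
            * (if u ⬝ᵥ y = b then (-1 : ℝ) else 1) := by
          rw [sum_comm]
          exact sum_congr rfl fun x _ => sum_comm
      _ = _ := by simp only [ite_mul, zero_mul, sum_ite_eq, mem_univ, if_true]
  rw [sum_congr rfl hcollapse, sum_comm]
  have hx : ∀ x, ∑ u : Fin n → ZMod 2 with u ≠ 0,
      ∑ y, 2 / 2 ^ n * k x y * (if u ⬝ᵥ y = u ⬝ᵥ x then (-1 : ℝ) else 1)
      = 2 / 2 ^ n - 2 * k x x := by
    intro x
    rw [sum_comm]
    have hy : ∀ y, ∑ u : Fin n → ZMod 2 with u ≠ 0,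
        2 / 2 ^ n * k x y * (if u ⬝ᵥ y = u ⬝ᵥ x then (-1 : ℝ) else 1)
        = 2 / 2 ^ n * k x y - (if x = y then 2 * k x y else 0) := by
      intro y
      rw [← mul_sum, sum_ne_zero_sign_dotProduct]
      split_ifs <;> field_simp
      ring
    simp only [hy, sum_sub_distrib, ← mul_sum, hk, sum_ite_eq, mem_univ, if_true, mul_one]
  simp only [hx, sum_sub_distrib, ← mul_sum]
  simp
  field_simp


/-- (Unconditional exponential violation of classicality.)
The supremum of the expected score `V(F_BV, h)` over all classical strategies equals
`1/(2^n − 1)` and is attained; the supremum over all strategies equals `1` and is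
attained; hence the ratio of the optimal value over all strategies to the optimal
classical value equals `2^n − 1`. -/
theorem stmt8 (n : ℕ) (hn : 1 ≤ n)
    (Sub : (Fin n → ZMod 2) → ZMod 2 → Finset (Fin n → ZMod 2))
    (hSub : ∀ u b, Sub u b = Finset.univ.filter (fun x : Fin n → ZMod 2 => ∑ i, u i * x i = b))
    (V : (Finset (Fin n → ZMod 2) → (Fin n → ZMod 2) → ℝ) → ℝ)
    (hV : ∀ h, V h = (1 / (2 * ((2 : ℝ) ^ n - 1))) *
      ∑ u ∈ Finset.univ.filter (fun u : Fin n → ZMod 2 => u ≠ 0), ∑ b : ZMod 2,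
        ∑ y : Fin n → ZMod 2, h (Sub u b) y * (if y ∈ Sub u b then (-1 : ℝ) else 1)) :
    IsGreatest {v : ℝ | ∃ k : (Fin n → ZMod 2) → (Fin n → ZMod 2) → ℝ,
        (∀ x y, 0 ≤ k x y) ∧ (∀ x, ∑ y, k x y = 1) ∧
        v = V (fun S y => ∑ x ∈ S, ((S.card : ℝ))⁻¹ * k x y)}
      (1 / ((2 : ℝ) ^ n - 1)) ∧
    IsGreatest {v : ℝ | ∃ h : Finset (Fin n → ZMod 2) → (Fin n → ZMod 2) → ℝ,
        (∀ u : Fin n → ZMod 2, u ≠ 0 → ∀ b : ZMod 2,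
          (∀ y, 0 ≤ h (Sub u b) y) ∧ ∑ y, h (Sub u b) y = 1) ∧ v = V h} 1 ∧
    (1 : ℝ) / (1 / ((2 : ℝ) ^ n - 1)) = (2 : ℝ) ^ n - 1 := by
  have hSub' : ∀ u b, Sub u b = ({x | u ⬝ᵥ x = b} : Finset (Fin n → ZMod 2)) := hSub
  have hN : (0 : ℝ) < 2 ^ n - 1 :=
    sub_pos.mpr (one_lt_pow₀ one_lt_two (Nat.one_le_iff_ne_zero.mp hn))
  have hcl : ∀ k : (Fin n → ZMod 2) → (Fin n → ZMod 2) → ℝ, (∀ x, ∑ y, k x y = 1) →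
      V (fun S y => ∑ x ∈ S, ((S.card : ℝ))⁻¹ * k x y)
        = 1 / ((2 : ℝ) ^ n - 1) * (1 - ∑ x, k x x) := by
    intro k hk
    rw [hV]
    simp only [hSub', mem_filter_univ]
    rw [sum_score_classical k hk]
    field_simp
  have hconst : 1 / (2 * ((2 : ℝ) ^ n - 1)) *
      ∑ u : Fin n → ZMod 2 with u ≠ 0, ∑ _b : ZMod 2, (1 : ℝ) = 1 := by
    simp only [sum_const, nsmul_eq_mul, card_filter_ne_zero_bitString]
    simp
    field_simp
  refine ⟨⟨?_, ?_⟩, ⟨?_, ?_⟩, one_div_one_div _⟩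
  · refine ⟨fun x y => if x + 1 = y then 1 else 0, fun x y => ?_, fun x => ?_, ?_⟩
    · dsimp only
      split_ifs <;> norm_num
    · simp
    · rw [hcl _ fun x => by simp]
      have h1 : (1 : Fin n → ZMod 2) ≠ 0 := fun h =>
        one_ne_zero (α := ZMod 2) (congrFun h ⟨0, hn⟩)
      simp [h1]
  · rintro v ⟨k, hk0, hk1, rfl⟩
    rw [hcl k hk1]
    have hdiag : 0 ≤ ∑ x, k x x := sum_nonneg fun x _ => hk0 x x
    exact mul_le_of_le_one_right (by positivity) (by linarith)
  · have hcompl : ∀ u : Fin n → ZMod 2, u ≠ 0 → ∀ b, ∃ y, y ∉ Sub u b := by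
      intro u hu b
      by_contra! hall
      have huniv : ({x | u ⬝ᵥ x = b} : Finset (Fin n → ZMod 2)) = univ :=
        eq_univ_iff_forall.mpr fun y => hSub' u b ▸ hall y
      have h := two_mul_card_filter_dotProduct_eq hu b
      rw [huniv] at h
      simp at h
    classical
    let f : Finset (Fin n → ZMod 2) → (Fin n → ZMod 2) :=
      fun S => if h : ∃ y, y ∉ S then h.choose else 0
    have hf : ∀ u : Fin n → ZMod 2, u ≠ 0 → ∀ b, f (Sub u b) ∉ Sub u b := by
      intro u hu b
      simp only [f, dif_pos (hcompl u hu b)]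
      exact (hcompl u hu b).choose_spec
    refine ⟨fun S y => if f S = y then 1 else 0, fun u hu b => ⟨fun y => ?_, by simp⟩, ?_⟩
    · dsimp only
      split_ifs <;> norm_num
    · rw [hV]
      refine hconst.symm.trans (congrArg _ ?_)
      refine sum_congr rfl fun u hu => sum_congr rfl fun b _ => ?_
      simp only [ite_mul, one_mul, zero_mul, sum_ite_eq, mem_univ, if_true,
        if_neg (hf u (mem_filter.mp hu).2 b)]
  · rintro v ⟨h, hh, rfl⟩
    rw [hV]
    refine le_of_le_of_eq ?_ hconst
    gcongr with u hu b _
    obtain ⟨h0, h1⟩ := hh u (mem_filter.mp hu).2 b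
    refine le_of_le_of_eq (sum_le_sum fun y _ => mul_le_of_le_one_right (h0 y) ?_) h1
    split_ifs <;> norm_num
end

section
/- (Classical sample-complexity upper bound for recovering the hidden string.) Let ε > 0 and m = n + ⌈log₂(1/ε)⌉. There exists a function A : ω^m → ω such that for every u ∈ ω \ {0} and every b ∈ F₂, if x₀, x₁, …, x_{m−1} are drawn i.i.d. uniformly (with replacement) from S_{u,b}, then A(x₀, x₁, …, x_{m−1}) = u with probability at least 1 − ε. -/
open Finset in
/-- If some `z` satisfies `u ⬝ z = 0` and `v ⬝ z = 1`, the form `v` is balanced on each level set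
of `u`. -/
theorem card_filter_dotProduct_mul_two {n : ℕ} (u v z : Fin n → ZMod 2) (hu : u ⬝ᵥ z = 0)
    (hv : v ⬝ᵥ z = 1) (b c : ZMod 2) :
    #{y | u ⬝ᵥ y = b ∧ v ⬝ᵥ y = c} * 2 = #{y | u ⬝ᵥ y = b} := by
  have hsplit : #{y | u ⬝ᵥ y = b ∧ v ⬝ᵥ y = c} + #{y | u ⬝ᵥ y = b ∧ ¬ v ⬝ᵥ y = c}
      = #{y | u ⬝ᵥ y = b} := by
    simp only [← filter_filter]
    exact card_filter_add_card_filter_not _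
  have hflip : ∀ a : ZMod 2, a + 1 = c ↔ ¬ a = c := by
    clear hsplit; revert c; decide
  have hshift : #{y | u ⬝ᵥ y = b ∧ ¬ v ⬝ᵥ y = c} = #{y | u ⬝ᵥ y = b ∧ v ⬝ᵥ y = c} := by
    refine card_equiv (Equiv.addRight z) fun y => ?_
    simp [dotProduct_add, hu, hv, hflip]
  omega

/-- `u` is a nonzero linear form that is constant along the samples `x`. -/
def IsConstantForm {m n : ℕ} (x : Fin m → Fin n → ZMod 2) (u : Fin n → ZMod 2) : Prop :=
  u ≠ 0 ∧ ∃ b, ∀ i, u ⬝ᵥ x i = b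

/-- A nonzero form, other than `u`, that is constant along samples from a level set of `u` yields
one that vanishes at a coordinate `j` where `u` does not. Coordinate `j` of the witness `w` encodes
the constant value. -/
theorem IsConstantForm.exists_update {m n : ℕ} {x : Fin m → Fin n → ZMod 2} {u v : Fin n → ZMod 2}
    {b : ZMod 2} (hx : ∀ i, u ⬝ᵥ x i = b) {j : Fin n} (hj : u j = 1)
    (hv : IsConstantForm x v) (hvu : v ≠ u) :
    ∃ w : Fin n → ZMod 2, Function.update w j 0 ≠ 0 ∧
      ∀ i, Function.update w j 0 ⬝ᵥ x i = w j := by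
  suffices ∃ w : Fin n → ZMod 2, w j = 0 ∧ w ≠ 0 ∧ ∃ c, ∀ i, w ⬝ᵥ x i = c by
    obtain ⟨w, hwj, hw, c, hc⟩ := this
    refine ⟨Function.update w j c, ?_, ?_⟩
    · rwa [Function.update_idem, ← hwj, Function.update_eq_self]
    · rw [Function.update_idem, ← hwj, Function.update_eq_self]
      simpa using hc
  obtain ⟨hv0, c, hc⟩ := hv
  have h01 : ∀ a : ZMod 2, a = 0 ∨ a = 1 := by decide
  rcases h01 (v j) with h | h
  · exact ⟨v, h, hv0, c, hc⟩
  · exact ⟨v - u, by simp [h, hj], sub_ne_zero.mpr hvu, c - b, by simp [sub_dotProduct, hx, hc]⟩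

/-- Two forms separated by a coordinate `j` with `u j = 1`, `v j = 0` are independent. -/
theorem exists_dotProduct_eq_zero_and_eq_one {n : ℕ} {u v : Fin n → ZMod 2} {j : Fin n}
    (huj : u j = 1) (hvj : v j = 0) (hv : v ≠ 0) : ∃ z, u ⬝ᵥ z = 0 ∧ v ⬝ᵥ z = 1 := by
  obtain ⟨k, hk⟩ := Function.ne_iff.mp hv
  have h1 : ∀ a : ZMod 2, a ≠ 0 → a = 1 := by decide
  refine ⟨Pi.single k 1 + Pi.single j (u k), ?_, ?_⟩
  · simp [dotProduct_add, huj, CharTwo.add_self_eq_zero]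
  · simp [dotProduct_add, hvj, h1 _ hk]

open Finset Classical in
/-- Few tuples of samples from a level set of `u` admit a second constant nonzero form. -/
theorem card_ambiguous_samples_mul_le {m n : ℕ} {u : Fin n → ZMod 2} (hu : u ≠ 0) (b : ZMod 2) :
    #{x : Fin m → Fin n → ZMod 2 | (∀ i, u ⬝ᵥ x i = b) ∧ ∃ v, IsConstantForm x v ∧ v ≠ u} * 2 ^ m
      ≤ 2 ^ n * #{y | u ⬝ᵥ y = b} ^ m := by
  obtain ⟨j, hj⟩ := Function.ne_iff.mp hu
  have h1 : ∀ a : ZMod 2, a ≠ 0 → a = 1 := by decide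
  have huj : u j = 1 := h1 _ hj
  let B (w : Fin n → ZMod 2) : Finset (Fin m → Fin n → ZMod 2) :=
    Fintype.piFinset fun _ => {y | u ⬝ᵥ y = b ∧ Function.update w j 0 ⬝ᵥ y = w j}
  have hsub : ({x : Fin m → Fin n → ZMod 2 |
      (∀ i, u ⬝ᵥ x i = b) ∧ ∃ v, IsConstantForm x v ∧ v ≠ u} : Finset _) ⊆
      ({w | Function.update w j 0 ≠ 0} : Finset (Fin n → ZMod 2)).biUnion B := by
    intro x hx
    simp only [mem_filter, mem_univ, true_and] at hx
    obtain ⟨hxb, v, hv, hvu⟩ := hx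
    obtain ⟨w, hw, hc⟩ := hv.exists_update hxb huj hvu
    simp only [mem_biUnion, mem_filter, mem_univ, true_and, B, Fintype.mem_piFinset]
    exact ⟨w, hw, fun i => ⟨hxb i, hc i⟩⟩
  have hB : ∀ w ∈ ({w | Function.update w j 0 ≠ 0} : Finset (Fin n → ZMod 2)),
      #(B w) * 2 ^ m = #{y | u ⬝ᵥ y = b} ^ m := by
    intro w hw
    obtain ⟨z, hz, hz'⟩ := exists_dotProduct_eq_zero_and_eq_one huj
      (Function.update_self j 0 w) (mem_filter.mp hw).2
    rw [Fintype.card_piFinset_const, ← mul_pow, card_filter_dotProduct_mul_two u _ z hz hz']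
  calc _ ≤ (∑ w ∈ ({w | Function.update w j 0 ≠ 0} : Finset (Fin n → ZMod 2)), #(B w)) * 2 ^ m :=
        Nat.mul_le_mul_right _ ((card_le_card hsub).trans card_biUnion_le)
    _ = #{w : Fin n → ZMod 2 | Function.update w j 0 ≠ 0} * #{y | u ⬝ᵥ y = b} ^ m := by
        rw [sum_mul, sum_congr rfl hB, sum_const, smul_eq_mul]
    _ ≤ _ := by
        refine Nat.mul_le_mul_right _ ((card_filter_le _ _).trans ?_)
        simp [ZMod.card]

/-- `2 ^ (-⌈log₂ (1 / ε)⌉₊) ≤ ε`. -/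
theorem one_div_two_pow_toNat_ceil_logb_le {ε : ℝ} (hε : 0 < ε) :
    1 / (2 : ℝ) ^ (⌈Real.logb 2 (1 / ε)⌉).toNat ≤ ε := by
  rw [one_div_le (by positivity) hε, ← Real.rpow_natCast,
    ← Real.logb_le_iff_le_rpow (by norm_num) (by positivity)]
  refine (Int.le_ceil _).trans ?_
  exact_mod_cast Int.self_le_toNat _


/-- (Classical sample-complexity upper bound for recovering the hidden
string.) Let `ε > 0` and `m = n + ⌈log₂(1/ε)⌉`. There exists a function `A : ω^m → ω`
such that for every `u ∈ ω \ {0}` and every `b ∈ F₂`, if `x₀, …, x_{m−1}` are drawn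
i.i.d. uniformly (with replacement) from `S_{u,b}`, then `A(x₀, …, x_{m−1}) = u` with
probability at least `1 − ε` (probability = fraction of tuples in `(S_{u,b})^m`). -/
theorem stmt13 (n : ℕ) (hn : 1 ≤ n) (ε : ℝ) (hε : 0 < ε)
    (m : ℕ) (hm : m = n + (⌈Real.logb 2 (1 / ε)⌉).toNat) :
    ∃ A : (Fin m → Fin n → ZMod 2) → (Fin n → ZMod 2),
      ∀ u : Fin n → ZMod 2, u ≠ 0 → ∀ b : ZMod 2,
        1 - ε ≤
          ((Finset.univ.filter (fun x : Fin m → Fin n → ZMod 2 =>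
              (∀ i, ∑ j, u j * x i j = b) ∧ A x = u)).card : ℝ) /
            (((Finset.univ.filter
                (fun y : Fin n → ZMod 2 => ∑ j, u j * y j = b)).card : ℝ) ^ m) := by
  classical
  have h1 : ∀ a : ZMod 2, a ≠ 0 → a = 1 := by decide
  refine ⟨fun x => if h : ∃ u, IsConstantForm x u then h.choose else 0, fun u hu b => ?_⟩
  set A : (Fin m → Fin n → ZMod 2) → (Fin n → ZMod 2) :=
    fun x => if h : ∃ u, IsConstantForm x u then h.choose else 0 with hA
  change 1 - ε ≤ ((Finset.univ.filter (fun x : Fin m → Fin n → ZMod 2 =>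
      (∀ i, u ⬝ᵥ x i = b) ∧ A x = u)).card : ℝ) /
    (((Finset.univ.filter (fun y : Fin n → ZMod 2 => u ⬝ᵥ y = b)).card : ℝ) ^ m)
  set S := Finset.univ.filter (fun y : Fin n → ZMod 2 => u ⬝ᵥ y = b) with hS
  set G := Finset.univ.filter (fun x : Fin m → Fin n → ZMod 2 =>
    (∀ i, u ⬝ᵥ x i = b) ∧ A x = u) with hG
  have hbad := card_ambiguous_samples_mul_le (m := m) hu b
  set B := Finset.univ.filter (fun x : Fin m → Fin n → ZMod 2 =>
    (∀ i, u ⬝ᵥ x i = b) ∧ ∃ v, IsConstantForm x v ∧ v ≠ u) with hB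
  have hcover : (Fintype.piFinset fun _ : Fin m => S) ⊆ G ∪ B := by
    intro x hx
    have hxb : ∀ i, u ⬝ᵥ x i = b := by simpa [hS] using hx
    have hex : ∃ u, IsConstantForm x u := ⟨u, hu, b, hxb⟩
    have hAx : IsConstantForm x (A x) := by
      simp only [hA, dif_pos hex]
      exact hex.choose_spec
    by_cases h : A x = u
    · exact Finset.mem_union_left _ (by simp [hG, hxb, h])
    · exact Finset.mem_union_right _ (by
        simp only [hB, Finset.mem_filter, Finset.mem_univ, true_and]
        exact ⟨hxb, A x, hAx, h⟩)
  have hcard : S.card ^ m ≤ G.card + B.card := by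
    rw [← Fintype.card_piFinset_const]
    exact (Finset.card_le_card hcover).trans (Finset.card_union_le _ _)
  have hSpos : 0 < S.card := by
    obtain ⟨j, hj⟩ := Function.ne_iff.mp hu
    exact Finset.card_pos.mpr ⟨Pi.single j b, by simp [hS, h1 _ hj]⟩
  have hcardR : (S.card : ℝ) ^ m ≤ G.card + B.card := by exact_mod_cast hcard
  have hbadR : (B.card : ℝ) * 2 ^ m ≤ 2 ^ n * (S.card : ℝ) ^ m := by exact_mod_cast hbad
  have hSm : (0 : ℝ) < (S.card : ℝ) ^ m := by positivity
  have hBε : (B.card : ℝ) ≤ ε * (S.card : ℝ) ^ m := by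
    refine le_trans ?_ (mul_le_mul_of_nonneg_right (one_div_two_pow_toNat_ceil_logb_le hε) hSm.le)
    rw [div_mul_eq_mul_div, one_mul, le_div_iff₀ (by positivity)]
    have hpow : (2 : ℝ) ^ m = 2 ^ n * 2 ^ (⌈Real.logb 2 (1 / ε)⌉).toNat := by rw [← pow_add, ← hm]
    rw [hpow] at hbadR
    refine le_of_mul_le_mul_left (a := (2 : ℝ) ^ n) ?_ (by positivity)
    linarith
  rw [le_div_iff₀ hSm]
  linarith
end

section
/- (Classical sample-complexity lower bound.) Let 1 ≤ q ≤ n and let A : ω^q → ω be any function (a deterministic classical algorithm). Let (u, b) be uniformly distributed on (ω \ {0}) × F₂ and, conditionally on (u, b), let x₁, …, x_q be i.i.d. uniform on S_{u,b}. Then the probability that A(x₁, …, x_q) lies in the complement ω \ S_{u,b} (equivalently, that u·A(x₁,…,x_q) = 1 − b) is at most 1/2 + 1/(2(2^{n−q+1} − 1)). -/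
open Finset in
/-- Exactly half of the vectors lie on each side of a nonzero linear functional over `ZMod 2`. -/
theorem two_mul_card_filter_sum_mul_eq {n : ℕ} {u : Fin n → ZMod 2} (hu : u ≠ 0) (b : ZMod 2) :
    2 * #{x : Fin n → ZMod 2 | ∑ j, u j * x j = b} = 2 ^ n := by
  obtain ⟨k, hk⟩ := Function.ne_iff.mp hu
  have huk : u k = 1 := by
    have h : ∀ a : ZMod 2, a ≠ 0 → a = 1 := by decide
    exact h _ hk
  have shift : ∀ x : Fin n → ZMod 2,
      ∑ j, u j * (x + Pi.single k 1 : Fin n → ZMod 2) j = ∑ j, u j * x j + 1 := by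
    intro x
    simp [mul_add, sum_add_distrib, Pi.single_apply, huk]
  have hcard : #{x : Fin n → ZMod 2 | ∑ j, u j * x j = b} =
      #{x : Fin n → ZMod 2 | ¬ ∑ j, u j * x j = b} := by
    refine card_equiv (Equiv.addRight (Pi.single k 1)) fun x => ?_
    have h : ∀ a b : ZMod 2, a = b ↔ ¬ a + 1 = b := by decide
    simp only [mem_filter, mem_univ, true_and, Equiv.coe_addRight, shift]
    exact h _ _
  have hsum := card_filter_add_card_filter_not (s := (univ : Finset (Fin n → ZMod 2)))
    (fun x => ∑ j, u j * x j = b)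
  have huniv : #(univ : Finset (Fin n → ZMod 2)) = 2 ^ n := by simp [ZMod.card]
  omega

open Finset in
theorem card_filter_forall_sum_mul_eq {n q : ℕ} (hn : 1 ≤ n) {u : Fin n → ZMod 2} (hu : u ≠ 0)
    (b : ZMod 2) :
    #{x : Fin q → Fin n → ZMod 2 | ∀ i, ∑ j, u j * x i j = b} = (2 ^ (n - 1)) ^ q := by
  have h : ({x : Fin q → Fin n → ZMod 2 | ∀ i, ∑ j, u j * x i j = b} : Finset _) =
      Fintype.piFinset fun _ => {y : Fin n → ZMod 2 | ∑ j, u j * y j = b} := by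
    ext x
    simp
  have h2 := two_mul_card_filter_sum_mul_eq hu b
  obtain ⟨m, rfl⟩ := Nat.exists_eq_add_of_le' hn
  rw [h, Fintype.card_piFinset_const]
  congr 1
  simp only [Nat.add_sub_cancel]
  rw [pow_succ] at h2
  omega

open Finset in
/-- Double counting: the label `b` is determined by `u` and the first sample. -/
theorem sum_card_filter_forall_sum_mul_eq {n k : ℕ} (s : Finset (Fin n → ZMod 2))
    (Q : (Fin n → ZMod 2) → (Fin (k + 1) → Fin n → ZMod 2) → ZMod 2 → Prop)
    [∀ u x b, Decidable (Q u x b)] :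
    ∑ u ∈ s, ∑ b : ZMod 2, #{x : Fin (k + 1) → Fin n → ZMod 2 |
        (∀ i, ∑ j, u j * x i j = b) ∧ Q u x b} =
      ∑ x : Fin (k + 1) → Fin n → ZMod 2,
        #{u ∈ s | (∀ i : Fin k, ∑ j, u j * x i.succ j = ∑ j, u j * x 0 j) ∧
          Q u x (∑ j, u j * x 0 j)} := by
  simp only [card_filter]
  rw [sum_comm (s := univ) (t := s)]
  refine sum_congr rfl fun u _ => ?_
  rw [sum_comm]
  refine sum_congr rfl fun x _ => ?_
  rw [sum_eq_single (∑ j, u j * x 0 j)]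
  · simp [Fin.forall_fin_succ]
  · intro b _ hb
    exact if_neg fun h => hb (h.1 0).symm
  · simp

open Finset in
/-- The common kernel of `k` linear functionals on `(ZMod 2)^n` has at least `2 ^ (n - k)`
elements. -/
theorem two_pow_le_card_filter_forall_sum_mul_eq {n k : ℕ} (hk : k ≤ n)
    (x : Fin (k + 1) → Fin n → ZMod 2) :
    2 ^ (n - k) ≤ #{u : Fin n → ZMod 2 |
      ∀ i : Fin k, ∑ j, u j * x i.succ j = ∑ j, u j * x 0 j} := by
  set L : (Fin n → ZMod 2) →ₗ[ZMod 2] (Fin k → ZMod 2) :=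
    Matrix.mulVecLin (Matrix.of fun i j => x i.succ j - x 0 j) with hL
  have hker : #{u : Fin n → ZMod 2 |
      ∀ i : Fin k, ∑ j, u j * x i.succ j = ∑ j, u j * x 0 j} = Nat.card L.ker := by
    rw [← Fintype.card_subtype, ← Nat.card_eq_fintype_card]
    refine Nat.card_congr (Equiv.subtypeEquivRight fun u => ?_)
    simp [hL, LinearMap.mem_ker, funext_iff, Matrix.mulVec, dotProduct, sub_mul, sub_eq_zero,
      mul_comm (u _)]
  have hrank := L.finrank_range_add_finrank_ker
  have hrange := L.range.finrank_le
  rw [Module.finrank_fin_fun] at hrank hrange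
  rw [hker, Module.natCard_eq_pow_finrank (K := ZMod 2), Nat.card_zmod]
  exact Nat.pow_le_pow_right two_pos (by omega)

open Finset in
/-- A linear functional takes the value `1` on at most half of the solutions of a homogeneous
linear system over `ZMod 2`. -/
theorem two_mul_card_filter_forall_sum_mul_eq_and_le {n k : ℕ}
    (x : Fin (k + 1) → Fin n → ZMod 2) (a : Fin n → ZMod 2) :
    2 * #{u : Fin n → ZMod 2 |
        (∀ i : Fin k, ∑ j, u j * x i.succ j = ∑ j, u j * x 0 j) ∧
          ∑ j, u j * a j = 1 - ∑ j, u j * x 0 j} ≤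
      #{u : Fin n → ZMod 2 | ∀ i : Fin k, ∑ j, u j * x i.succ j = ∑ j, u j * x 0 j} := by
  rw [← filter_filter]
  set V : Finset (Fin n → ZMod 2) :=
    {u | ∀ i : Fin k, ∑ j, u j * x i.succ j = ∑ j, u j * x 0 j} with hV
  obtain h | ⟨v, hv⟩ := (V.filter fun u => ∑ j, u j * a j = 1 - ∑ j, u j * x 0 j).eq_empty_or_nonempty
  · simp [h]
  have hle : #{u ∈ V | ∑ j, u j * a j = 1 - ∑ j, u j * x 0 j} ≤
      #{u ∈ V | ¬ ∑ j, u j * a j = 1 - ∑ j, u j * x 0 j} := by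
    refine card_le_card_of_injOn (· + v) ?_ (add_left_injective v).injOn
    intro u hu
    simp only [hV, coe_filter, mem_filter, mem_univ, true_and, Set.mem_ofPred_eq] at hu hv ⊢
    simp only [Pi.add_apply, add_mul, sum_add_distrib]
    refine ⟨fun i => by rw [hu.1 i, hv.1 i], ?_⟩
    rw [hu.2, hv.2]
    generalize ∑ j, u j * x 0 j = c
    generalize ∑ j, v j * x 0 j = d
    revert c d
    decide
  have := card_filter_add_card_filter_not (s := V)
    (fun u => ∑ j, u j * a j = 1 - ∑ j, u j * x 0 j)
  omega

open Finset in
/-- For fixed samples `x`, comparison of the hidden vectors for which `a` is a correct answer with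
all consistent hidden vectors. -/
theorem card_filter_and_mul_le {n k : ℕ} (hk : k ≤ n)
    (x : Fin (k + 1) → Fin n → ZMod 2) (a : Fin n → ZMod 2) :
    2 * ((2 : ℝ) ^ (n - k) - 1) * #{u ∈ univ.filter (fun u : Fin n → ZMod 2 => u ≠ 0) |
        (∀ i : Fin k, ∑ j, u j * x i.succ j = ∑ j, u j * x 0 j) ∧
          ∑ j, u j * a j = 1 - ∑ j, u j * x 0 j} ≤
      2 ^ (n - k) * #{u ∈ univ.filter (fun u : Fin n → ZMod 2 => u ≠ 0) |
        (∀ i : Fin k, ∑ j, u j * x i.succ j = ∑ j, u j * x 0 j) ∧ True} := by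
  have hT : #{u ∈ univ.filter (fun u : Fin n → ZMod 2 => u ≠ 0) |
        (∀ i : Fin k, ∑ j, u j * x i.succ j = ∑ j, u j * x 0 j) ∧ True} + 1 =
      #{u : Fin n → ZMod 2 | ∀ i : Fin k, ∑ j, u j * x i.succ j = ∑ j, u j * x 0 j} := by
    rw [filter_ne', filter_erase]
    simp only [and_true]
    exact card_erase_add_one (by simp)
  have hW : 2 * #{u ∈ univ.filter (fun u : Fin n → ZMod 2 => u ≠ 0) |
        (∀ i : Fin k, ∑ j, u j * x i.succ j = ∑ j, u j * x 0 j) ∧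
          ∑ j, u j * a j = 1 - ∑ j, u j * x 0 j} ≤ _ :=
    (Nat.mul_le_mul_left 2 (card_le_card (filter_subset_filter _ (subset_univ _)))).trans
      (two_mul_card_filter_forall_sum_mul_eq_and_le x a)
  have hM := two_pow_le_card_filter_forall_sum_mul_eq hk x
  rw [← hT] at hW hM
  generalize #{u ∈ univ.filter (fun u : Fin n → ZMod 2 => u ≠ 0) |
        (∀ i : Fin k, ∑ j, u j * x i.succ j = ∑ j, u j * x 0 j) ∧ True} = T at *
  generalize #{u ∈ univ.filter (fun u : Fin n → ZMod 2 => u ≠ 0) |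
        (∀ i : Fin k, ∑ j, u j * x i.succ j = ∑ j, u j * x 0 j) ∧
          ∑ j, u j * a j = 1 - ∑ j, u j * x 0 j} = W at *
  have hW' : (2 : ℝ) * W ≤ T + 1 := by exact_mod_cast hW
  have hM' : (2 : ℝ) ^ (n - k) ≤ T + 1 := by exact_mod_cast hM
  have h1 : (1 : ℝ) ≤ 2 ^ (n - k) := one_le_pow₀ one_le_two
  nlinarith [mul_le_mul_of_nonneg_left hW' (sub_nonneg.mpr h1)]


/-- (Classical sample-complexity lower bound.) Let `1 ≤ q ≤ n` and let
`A : ω^q → ω` be any function (a deterministic classical algorithm). Let `(u, b)` be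
uniform on `(ω \ {0}) × F₂` and, conditionally on `(u, b)`, let `x₁, …, x_q` be i.i.d.
uniform on `S_{u,b}` (which has `2^{n−1}` elements). Then the probability that
`A(x₁, …, x_q) ∈ ω \ S_{u,b}` (equivalently `u·A(x) = 1 − b`) is at most
`1/2 + 1/(2(2^{n−q+1} − 1))`. -/
theorem stmt16 (n q : ℕ) (hn : 1 ≤ n) (hq1 : 1 ≤ q) (hqn : q ≤ n)
    (A : (Fin q → Fin n → ZMod 2) → (Fin n → ZMod 2)) :
    (1 / (2 * ((2 : ℝ) ^ n - 1))) *
      ∑ u ∈ Finset.univ.filter (fun u : Fin n → ZMod 2 => u ≠ 0), ∑ b : ZMod 2,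
        ((Finset.univ.filter (fun x : Fin q → Fin n → ZMod 2 =>
            (∀ i, ∑ j, u j * x i j = b) ∧ ∑ j, u j * A x j = 1 - b)).card : ℝ) /
          ((2 : ℝ) ^ (n - 1)) ^ q
    ≤ 1 / 2 + 1 / (2 * ((2 : ℝ) ^ (n - q + 1) - 1)) := by
  obtain ⟨k, rfl⟩ := Nat.exists_eq_add_of_le' hq1
  have hexp : n - (k + 1) + 1 = n - k := by omega
  have hM : (2 : ℝ) ≤ 2 ^ (n - k) := le_self_pow₀ one_le_two (by omega)
  have hN : (2 : ℝ) ≤ 2 ^ n := le_self_pow₀ one_le_two (by omega)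
  have htotal := sum_card_filter_forall_sum_mul_eq (k := k)
    (Finset.univ.filter fun u : Fin n → ZMod 2 => u ≠ 0) (fun _ _ _ => True)
  have hcount : ∑ u ∈ Finset.univ.filter (fun u : Fin n → ZMod 2 => u ≠ 0), ∑ b : ZMod 2,
      (Finset.univ.filter (fun x : Fin (k + 1) → Fin n → ZMod 2 =>
        (∀ i, ∑ j, u j * x i j = b) ∧ True)).card =
      (2 ^ n - 1) * (2 * (2 ^ (n - 1)) ^ (k + 1)) := by
    rw [Finset.sum_congr rfl fun u hu => Finset.sum_congr rfl fun b _ => by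
      simpa only [and_true] using
        card_filter_forall_sum_mul_eq hn (Finset.mem_filter.mp hu).2 b]
    simp [Finset.filter_ne', ZMod.card]
  have hwin := sum_card_filter_forall_sum_mul_eq (k := k)
    (Finset.univ.filter fun u : Fin n → ZMod 2 => u ≠ 0)
    (fun u x b => ∑ j, u j * A x j = 1 - b)
  have hle := Finset.sum_le_sum fun x (_ : x ∈ Finset.univ) =>
    card_filter_and_mul_le (show k ≤ n by omega) x (A x)
  rw [← Finset.mul_sum, ← Finset.mul_sum, ← Nat.cast_sum, ← Nat.cast_sum, ← hwin, ← htotal,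
    hcount] at hle
  simp only [← Finset.sum_div, ← Nat.cast_sum]
  rw [hexp]
  generalize (∑ u ∈ Finset.univ.filter (fun u : Fin n → ZMod 2 => u ≠ 0), ∑ b : ZMod 2,
      (Finset.univ.filter (fun x : Fin (k + 1) → Fin n → ZMod 2 =>
        (∀ i, ∑ j, u j * x i j = b) ∧ ∑ j, u j * A x j = 1 - b)).card) = W at *
  push_cast [Nat.one_le_two_pow] at hle
  have hK : (0 : ℝ) < (2 ^ (n - 1)) ^ (k + 1) := by positivity
  generalize ((2 : ℝ) ^ (n - 1)) ^ (k + 1) = K at *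
  generalize (2 : ℝ) ^ (n - k) = M at *
  generalize (2 : ℝ) ^ n = N at *
  have hM1 : 0 < M - 1 := by linarith
  have hN1 : 0 < N - 1 := by linarith
  have hrhs : 1 / 2 + 1 / (2 * (M - 1)) = M / (2 * (M - 1)) := by
    field_simp
    ring
  rw [hrhs, div_mul_div_comm, one_mul, div_le_div_iff₀ (by positivity) (by positivity)]
  linarith
end
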